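/- arXiv:1509.04178 — 5 statements merged into one kernel-verified Lean document; each statement's English description precedes it below -/
import Mathlib

section
/- Let n ≥ 1, let SO(n) be the real special orthogonal group of n×n matrices, and let μ be a Haar measure on the compact group SO(n). Then for every real n×n matrix A, ∫_{U ∈ SO(n)} det(I_n − U·A) dμ(U) = μ(SO(n)) · (1 + (−1)^n · det A). -/
open MeasureTheory

namespace SOInt

/-- Bounded entries of orthogonal matrices. -/
lemma abs_entry_le {n : ℕ} {U : Matrix (Fin n) (Fin n) ℝ}
    (hU : U ∈ Matrix.specialOrthogonalGroup (Fin n) ℝ) (i j : Fin n) :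
    U i j ∈ Set.Icc (-1 : ℝ) 1 := by
  have h := (Matrix.mem_orthogonalGroup_iff _ _).1 (Matrix.mem_specialOrthogonalGroup_iff.1 hU).1
  have h1 : ∑ k, U i k * U i k = 1 := by
    have := congrFun (congrFun h i) i
    simpa [Matrix.mul_apply] using this
  have h2 : U i j * U i j ≤ ∑ k, U i k * U i k :=
    Finset.single_le_sum (f := fun k => U i k * U i k)
      (fun k _ => mul_self_nonneg _) (Finset.mem_univ j)
  constructor <;> nlinarith

lemma isCompact_SO (n : ℕ) :
    IsCompact (Matrix.specialOrthogonalGroup (Fin n) ℝ : Set (Matrix (Fin n) (Fin n) ℝ)) := by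
  have hK : IsCompact (Set.univ.pi fun _ : Fin n => Set.univ.pi fun _ : Fin n =>
      Set.Icc (-1 : ℝ) 1) :=
    isCompact_univ_pi fun _ => isCompact_univ_pi fun _ => isCompact_Icc
  refine IsCompact.of_isClosed_subset hK ?_ ?_
  · have : (Matrix.specialOrthogonalGroup (Fin n) ℝ : Set (Matrix (Fin n) (Fin n) ℝ))
        = {U | U * U.transpose = 1} ∩ {U | U.det = 1} := by
      ext U
      simp only [SetLike.mem_coe, Matrix.mem_specialOrthogonalGroup_iff,
        Matrix.mem_orthogonalGroup_iff]
      rfl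
    rw [this]
    refine IsClosed.inter (isClosed_eq ?_ continuous_const) (isClosed_eq ?_ continuous_const)
    · exact continuous_id.matrix_mul continuous_id.matrix_transpose
    · exact continuous_id.matrix_det
  · intro U hU i _ j _
    exact abs_entry_le hU i j

/-- The signs `-1` at `i, j` and `1` elsewhere. -/
def sg {n : ℕ} (i j : Fin n) : Fin n → ℝ := fun k => (if k = i then -1 else 1) * (if k = j then -1 else 1)

lemma sg_sq {n : ℕ} (i j k : Fin n) : sg i j k * sg i j k = 1 := by
  unfold sg; split_ifs <;> norm_num

/-- The corresponding diagonal element of `SO(n)`. -/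
def D {n : ℕ} (i j : Fin n) : Matrix.specialOrthogonalGroup (Fin n) ℝ :=
  ⟨Matrix.diagonal (sg i j), by
    rw [Matrix.mem_specialOrthogonalGroup_iff, Matrix.mem_orthogonalGroup_iff]
    constructor
    · rw [Matrix.diagonal_transpose, Matrix.diagonal_mul_diagonal]
      simp [sg_sq]
    · simp only [Matrix.det_diagonal, sg]
      rw [Finset.prod_mul_distrib, Finset.prod_ite_eq', Finset.prod_ite_eq']
      simp⟩

/-- The mixed determinant. -/
def F {n : ℕ} (A : Matrix (Fin n) (Fin n) ℝ) (s : Finset (Fin n))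
    (U : Matrix (Fin n) (Fin n) ℝ) : ℝ :=
  Matrix.det (Matrix.of fun a b => if a ∈ s then (1 : Matrix (Fin n) (Fin n) ℝ) a b
    else (-(U * A)) a b)

lemma det_eq {n : ℕ} (A U : Matrix (Fin n) (Fin n) ℝ) :
    (1 - U * A).det = ∑ s : Finset (Fin n), F A s U := by
  have h := (Matrix.detRowAlternating (R := ℝ) (n := Fin n)).toMultilinearMap.map_add_univ
    (1 : Matrix (Fin n) (Fin n) ℝ) (-(U * A))
  rw [sub_eq_add_neg]
  refine Eq.trans h (Finset.sum_congr rfl fun s _ => ?_)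
  change Matrix.det _ = Matrix.det _
  congr 1
  ext a b
  simp only [Finset.piecewise, Matrix.of_apply]
  split_ifs <;> rfl

lemma F_cont {n : ℕ} (A : Matrix (Fin n) (Fin n) ℝ) (s : Finset (Fin n)) :
    Continuous (F A s) := by
  refine Continuous.matrix_det ?_
  refine continuous_matrix fun a b => ?_
  have h : Continuous fun U : Matrix (Fin n) (Fin n) ℝ => -(U * A) :=
    (continuous_id.matrix_mul continuous_const).neg
  by_cases ha : a ∈ s
  · simpa [ha] using continuous_const
  · simpa only [Matrix.of_apply, ha, if_false] using h.matrix_elem a b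

lemma F_D {n : ℕ} (A : Matrix (Fin n) (Fin n) ℝ) (s : Finset (Fin n)) (i j : Fin n)
    (hi : i ∉ s) (hj : j ∈ s) (U : Matrix (Fin n) (Fin n) ℝ) :
    F A s ((D i j : Matrix (Fin n) (Fin n) ℝ) * U) = - F A s U := by
  have h := Matrix.det_mul_column (fun k : Fin n => if k = i then (-1 : ℝ) else 1)
    (Matrix.of fun a b => if a ∈ s then (1 : Matrix (Fin n) (Fin n) ℝ) a b
      else (-(U * A)) a b)
  rw [Finset.prod_ite_eq' Finset.univ i] at h
  simp only [Finset.mem_univ, if_true, neg_one_mul] at h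
  unfold F
  rw [← h]
  congr 1
  ext a b
  simp only [Matrix.of_apply]
  by_cases ha : a ∈ s
  · have : a ≠ i := fun e => hi (e ▸ ha)
    simp [ha, this]
  · have : a ≠ j := fun e => ha (e ▸ hj)
    simp [ha, this, D, sg, Matrix.mul_assoc, Matrix.diagonal_mul]

end SOInt

/-- For a Haar measure `μ` on the compact group `SO(n)` (`n ≥ 1`), i.e. a left-invariant
measure which is finite on compacts and positive on opens, and any real `n × n` matrix `A`,
`∫_{U ∈ SO(n)} det (1 - U * A) dμ(U) = μ(SO(n)) * (1 + (-1)^n * det A)`. -/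
theorem integral_det_one_sub_mul_specialOrthogonalGroup
    (n : ℕ) (hn : 1 ≤ n)
    [MeasurableSpace (Matrix.specialOrthogonalGroup (Fin n) ℝ)]
    [BorelSpace (Matrix.specialOrthogonalGroup (Fin n) ℝ)]
    (μ : Measure (Matrix.specialOrthogonalGroup (Fin n) ℝ))
    [IsFiniteMeasureOnCompacts μ] [μ.IsMulLeftInvariant] [μ.IsOpenPosMeasure]
    (A : Matrix (Fin n) (Fin n) ℝ) :
    ∫ U : Matrix.specialOrthogonalGroup (Fin n) ℝ,
        ((1 : Matrix (Fin n) (Fin n) ℝ) - (U : Matrix (Fin n) (Fin n) ℝ) * A).det ∂μ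
      = (μ Set.univ).toReal * (1 + (-1 : ℝ) ^ n * A.det) := by
  classical
  haveI : CompactSpace (Matrix.specialOrthogonalGroup (Fin n) ℝ) :=
    isCompact_iff_compactSpace.1 (SOInt.isCompact_SO n)
  haveI : IsFiniteMeasure μ := ⟨isCompact_univ.measure_lt_top⟩
  have hc : ∀ s : Finset (Fin n), Continuous fun U : Matrix.specialOrthogonalGroup (Fin n) ℝ =>
      SOInt.F A s (U : Matrix (Fin n) (Fin n) ℝ) := fun s =>
    (SOInt.F_cont A s).comp continuous_subtype_val
  have hint : ∀ s : Finset (Fin n), Integrable (fun U : Matrix.specialOrthogonalGroup (Fin n) ℝ =>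
      SOInt.F A s (U : Matrix (Fin n) (Fin n) ℝ)) μ := fun s =>
    (hc s).integrable_of_hasCompactSupport (HasCompactSupport.of_compactSpace _)
  simp_rw [SOInt.det_eq]
  rw [integral_finsetSum _ fun s _ => hint s]
  have hne : (Finset.univ : Finset (Fin n)) ≠ ∅ := by
    intro h
    have : (⟨0, hn⟩ : Fin n) ∈ (∅ : Finset (Fin n)) := h ▸ Finset.mem_univ _
    simp at this
  have hz : ∀ s : Finset (Fin n), s ∉ ({Finset.univ, ∅} : Finset (Finset (Fin n))) →
      ∫ U : Matrix.specialOrthogonalGroup (Fin n) ℝ,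
        SOInt.F A s (U : Matrix (Fin n) (Fin n) ℝ) ∂μ = 0 := by
    intro s hs
    simp only [Finset.mem_insert, Finset.mem_singleton, not_or] at hs
    obtain ⟨j, hj⟩ := Finset.nonempty_iff_ne_empty.2 hs.2
    obtain ⟨i, hi⟩ : ∃ i, i ∉ s := by
      by_contra! h
      exact hs.1 (Finset.eq_univ_iff_forall.2 h)
    have h := integral_mul_left_eq_self (μ := μ)
      (fun U : Matrix.specialOrthogonalGroup (Fin n) ℝ =>
        SOInt.F A s (U : Matrix (Fin n) (Fin n) ℝ)) (SOInt.D i j)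
    have h2 : ∀ U : Matrix.specialOrthogonalGroup (Fin n) ℝ,
        SOInt.F A s ((SOInt.D i j * U : Matrix.specialOrthogonalGroup (Fin n) ℝ) :
          Matrix (Fin n) (Fin n) ℝ) = - SOInt.F A s (U : Matrix (Fin n) (Fin n) ℝ) :=
      fun U => SOInt.F_D A s i j hi hj U
    simp_rw [h2] at h
    rw [integral_neg] at h
    linarith
  rw [← Finset.sum_subset (Finset.subset_univ {Finset.univ, ∅}) fun s _ hs => hz s hs,
    Finset.sum_pair hne]
  have e1 : ∀ U : Matrix.specialOrthogonalGroup (Fin n) ℝ,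
      SOInt.F A Finset.univ (U : Matrix (Fin n) (Fin n) ℝ) = 1 := by
    intro U
    have : (Matrix.of fun a b => if a ∈ (Finset.univ : Finset (Fin n)) then
        (1 : Matrix (Fin n) (Fin n) ℝ) a b
        else (-((U : Matrix (Fin n) (Fin n) ℝ) * A)) a b) = 1 := by
      ext a b; simp
    rw [SOInt.F, this, Matrix.det_one]
  have e2 : ∀ U : Matrix.specialOrthogonalGroup (Fin n) ℝ,
      SOInt.F A ∅ (U : Matrix (Fin n) (Fin n) ℝ) = (-1) ^ n * A.det := by
    intro U
    have : (Matrix.of fun a b => if a ∈ (∅ : Finset (Fin n)) then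
        (1 : Matrix (Fin n) (Fin n) ℝ) a b
        else (-((U : Matrix (Fin n) (Fin n) ℝ) * A)) a b)
        = -((U : Matrix (Fin n) (Fin n) ℝ) * A) := by
      ext a b; simp
    rw [SOInt.F, this, Matrix.det_neg, Matrix.det_mul,
      (Matrix.mem_specialOrthogonalGroup_iff.1 U.2).2, Fintype.card_fin, one_mul]
  simp_rw [e1, e2]
  simp only [integral_const, smul_eq_mul, Measure.real]
  ring
end

section
/- Let n ≥ 2, let SO(n) be the real special orthogonal group with a Haar measure μ, and let P be a finite set of indices in {1,…,n} with 0 < |P| < n. Then for every real n×n matrix A, ∫_{U ∈ SO(n)} det((U·A)_P) dμ(U) = 0, where M_P denotes the square submatrix of M obtained by deleting all rows and columns whose index lies in P. -/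
open MeasureTheory

/-- For a Haar measure `μ` on `SO(n)` (`n ≥ 2`), a set `P` of indices with `0 < |P| < n`,
and any real `n × n` matrix `A`, the integral over `SO(n)` of the determinant of the
submatrix of `U * A` obtained by deleting the rows and columns with index in `P`
vanishes. -/
theorem integral_det_submatrix_mul_specialOrthogonalGroup_eq_zero
    (n : ℕ) (hn : 2 ≤ n)
    [MeasurableSpace (Matrix.specialOrthogonalGroup (Fin n) ℝ)]
    [BorelSpace (Matrix.specialOrthogonalGroup (Fin n) ℝ)]
    (μ : Measure (Matrix.specialOrthogonalGroup (Fin n) ℝ))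
    [IsFiniteMeasureOnCompacts μ] [μ.IsMulLeftInvariant] [μ.IsOpenPosMeasure]
    (P : Finset (Fin n)) (hP₀ : 0 < P.card) (hPn : P.card < n)
    (A : Matrix (Fin n) (Fin n) ℝ) :
    ∫ U : Matrix.specialOrthogonalGroup (Fin n) ℝ,
        (((U : Matrix (Fin n) (Fin n) ℝ) * A).submatrix
          (Subtype.val : {i : Fin n // i ∉ P} → Fin n)
          (Subtype.val : {i : Fin n // i ∉ P} → Fin n)).det ∂μ = 0 := by
  classical
  obtain ⟨p, hp⟩ := Finset.card_pos.mp hP₀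
  obtain ⟨q, hq⟩ : ∃ q, q ∉ P := by
    by_contra! h
    have : P = Finset.univ := Finset.eq_univ_iff_forall.mpr h
    simp [this] at hPn
  have hpq : p ≠ q := fun h => hq (h ▸ hp)
  let d : Fin n → ℝ := fun i => (if i = p then -1 else 1) * (if i = q then -1 else 1)
  have hd : ∀ i, d i * d i = 1 := by
    intro i
    simp only [d]
    split_ifs <;> norm_num
  have hD : Matrix.diagonal d ∈ Matrix.specialOrthogonalGroup (Fin n) ℝ := by
    rw [Matrix.mem_specialOrthogonalGroup_iff, Matrix.mem_orthogonalGroup_iff]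
    constructor
    · rw [Matrix.diagonal_transpose, Matrix.diagonal_mul_diagonal]
      simp [hd]
    · rw [Matrix.det_diagonal]
      simp only [d]
      rw [Finset.prod_mul_distrib, Finset.prod_ite_eq', Finset.prod_ite_eq']
      simp
  let f : Matrix.specialOrthogonalGroup (Fin n) ℝ → ℝ := fun U =>
    (((U : Matrix (Fin n) (Fin n) ℝ) * A).submatrix
          (Subtype.val : {i : Fin n // i ∉ P} → Fin n)
          (Subtype.val : {i : Fin n // i ∉ P} → Fin n)).det
  let D : Matrix.specialOrthogonalGroup (Fin n) ℝ := ⟨Matrix.diagonal d, hD⟩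
  have hf : ∀ U, f (D * U) = - f U := by
    intro U
    have h1 : ((((D * U : Matrix.specialOrthogonalGroup (Fin n) ℝ) :
          Matrix (Fin n) (Fin n) ℝ) * A).submatrix
          (Subtype.val : {i : Fin n // i ∉ P} → Fin n)
          (Subtype.val : {i : Fin n // i ∉ P} → Fin n)) =
        Matrix.diagonal (fun i : {i : Fin n // i ∉ P} => d i) *
        (((U : Matrix (Fin n) (Fin n) ℝ) * A).submatrix
          (Subtype.val : {i : Fin n // i ∉ P} → Fin n)
          (Subtype.val : {i : Fin n // i ∉ P} → Fin n)) := by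
      ext i j
      simp [D, Matrix.mul_assoc, Matrix.diagonal_mul]
    have h2 : ∏ i : {i : Fin n // i ∉ P}, d i = -1 := by
      rw [Finset.prod_eq_single (⟨q, hq⟩ : {i : Fin n // i ∉ P})]
      · simp [d, hpq.symm]
      · intro b _ hb
        have hbp : (b : Fin n) ≠ p := fun h => b.2 (h ▸ hp)
        have hbq : (b : Fin n) ≠ q := fun h => hb (Subtype.ext h)
        simp [d, hbp, hbq]
      · simp
    simp only [f]
    rw [h1, Matrix.det_mul, Matrix.det_diagonal, h2]
    ring
  have key : ∫ U, f (D * U) ∂μ = ∫ U, f U ∂μ := integral_mul_left_eq_self f D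
  simp only [hf, integral_neg] at key
  change ∫ U, f U ∂μ = 0
  linarith
end

section
/- Let n ≥ 0, let B be a real n×n matrix and λ a real number. Then det(λ·I_n − B) = Σ_{k=0}^{n} (−1)^{n−k} · λ^k · ( Σ_{P ⊆ {1,…,n}, |P| = k} det(B_P) ), where the inner sum ranges over all subsets P of the index set of cardinality k, and M_P denotes the square submatrix of M obtained by deleting all rows and columns whose index lies in P. -/
/-- For a real `n × n` matrix `B` and `lam : ℝ`,
`det (lam • 1 - B) = Σ_{k=0}^{n} (-1)^(n-k) lam^k Σ_{|P| = k} det (B_P)`,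
where `B_P` is the submatrix of `B` obtained by deleting the rows and columns with
index in `P`. -/
theorem det_smul_one_sub_eq_sum_det_submatrix
    (n : ℕ) (B : Matrix (Fin n) (Fin n) ℝ) (lam : ℝ) :
    (lam • (1 : Matrix (Fin n) (Fin n) ℝ) - B).det
      = ∑ k ∈ Finset.range (n + 1), (-1 : ℝ) ^ (n - k) * lam ^ k *
          ∑ P ∈ Finset.powersetCard k (Finset.univ : Finset (Fin n)),
            (B.submatrix
              (Subtype.val : {i : Fin n // i ∉ P} → Fin n)
              (Subtype.val : {i : Fin n // i ∉ P} → Fin n)).det := by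
  have h : (lam • (1 : Matrix (Fin n) (Fin n) ℝ) - B).det = B.charpoly.eval lam := by
    rw [Matrix.eval_charpoly, Matrix.smul_one_eq_diagonal]
    rfl
  have hdeg : B.charpoly.natDegree = n := by simp
  rw [h, Polynomial.eval_eq_sum_range, hdeg]
  refine Finset.sum_congr rfl fun k hk => ?_
  have hk' : k ≤ n := Nat.lt_succ_iff.mp (Finset.mem_range.mp hk)
  have hc := Matrix.charpoly_coeff_eq_sum_minors B (n - k) (by simp)
  rw [Fintype.card_fin, Nat.sub_sub_self hk'] at hc
  rw [hc, mul_right_comm]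
  congr 1
  refine Finset.sum_bij' (fun (s : Finset (Fin n)) _ => sᶜ) (fun (s : Finset (Fin n)) _ => sᶜ) ?_ ?_ ?_ ?_ ?_
  · intro s hs
    simp only [Finset.mem_powersetCard_univ] at hs ⊢
    rw [Finset.card_compl, Fintype.card_fin]
    omega
  · intro s hs
    simp only [Finset.mem_powersetCard_univ] at hs ⊢
    rw [Finset.card_compl, Fintype.card_fin]
    omega
  · intro s _
    exact compl_compl s
  · intro s _
    exact compl_compl s
  · intro s _
    rw [← Matrix.det_submatrix_equiv_self
      (Equiv.subtypeEquivRight (fun i => by simp) : {i // i ∉ sᶜ} ≃ {i // i ∈ s})]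
    rfl
end

section
/- Let E = ℝ^n (Euclidean space). Let f : E → E be continuously differentiable on a neighborhood of 0 with f(0) = 0 and ‖Df_0‖ < 1 (operator norm of the Fréchet derivative of f at 0). Let Φ : ℝ × E → E be continuously differentiable on a neighborhood of (0,0) and satisfy Φ(0, x) = x for all x in a neighborhood of 0; set X_0 = ∂_t Φ(t, 0)|_{t=0}. Then there exist ε > 0, a neighborhood W of 0 in E, and a curve x : (−ε, ε) → E with x(0) = 0 such that: for every t ∈ (−ε, ε), x(t) is the unique point of W fixed by y ↦ Φ(t, f(y)); moreover x is differentiable at 0 and its derivative v = x′(0) satisfies (Id − Df_0)(v) = X_0. In particular, since ‖Df_0‖ < 1 the operator Id − Df_0 is invertible and x′(0) = (Id − Df_0)^{−1}(X_0). -/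
open scoped Topology

/-- Fixed points of perturbations of a contracting map via the implicit function theorem:
if `f` is `C¹` near `0` with `f 0 = 0` and `‖Df₀‖ < 1`, and `Φ : ℝ × E → E` is `C¹` near
`(0,0)` with `Φ 0 = id` near `0`, then for small `t` the map `y ↦ Φ t (f y)` has a unique
fixed point `x t` near `0`, depending differentiably on `t` at `0`, with derivative `v`
satisfying `(Id - Df₀) v = d/dt|₀ Φ t 0`. -/
theorem exists_fixed_point_curve_of_contracting
    (n : ℕ) (f : EuclideanSpace ℝ (Fin n) → EuclideanSpace ℝ (Fin n))
    (Φ : ℝ → EuclideanSpace ℝ (Fin n) → EuclideanSpace ℝ (Fin n))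
    (hf : ContDiffAt ℝ 1 f 0) (hf0 : f 0 = 0)
    (hDf : ‖fderiv ℝ f 0‖ < 1)
    (hΦ : ContDiffAt ℝ 1 (fun p : ℝ × EuclideanSpace ℝ (Fin n) => Φ p.1 p.2)
      ((0 : ℝ), (0 : EuclideanSpace ℝ (Fin n))))
    (hΦ0 : ∀ᶠ x in 𝓝 (0 : EuclideanSpace ℝ (Fin n)), Φ 0 x = x) :
    ∃ ε > (0 : ℝ), ∃ W ∈ 𝓝 (0 : EuclideanSpace ℝ (Fin n)),
      ∃ x : ℝ → EuclideanSpace ℝ (Fin n),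
        x 0 = 0 ∧
        (∀ t ∈ Set.Ioo (-ε) ε, x t ∈ W ∧ ∀ y ∈ W, (Φ t (f y) = y ↔ y = x t)) ∧
        ∃ v : EuclideanSpace ℝ (Fin n),
          HasDerivAt x v 0 ∧
          (ContinuousLinearMap.id ℝ (EuclideanSpace ℝ (Fin n)) - fderiv ℝ f 0) v
            = deriv (fun t : ℝ => Φ t 0) 0 := by
  have hΦs := hΦ.hasStrictFDerivAt one_ne_zero
  have hfs := hf.hasStrictFDerivAt one_ne_zero
  set A := fderiv ℝ f 0 with hA
  set B := fderiv ℝ (fun p : ℝ × EuclideanSpace ℝ (Fin n) => Φ p.1 p.2) (0, 0) with hB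
  -- the spatial partial derivative of the flow is the identity
  have hBinr : B ∘L .inr ℝ ℝ (EuclideanSpace ℝ (Fin n)) = .id ℝ _ := by
    have h1 : HasFDerivAt (fun y => Φ 0 y)
        (B ∘L .inr ℝ ℝ (EuclideanSpace ℝ (Fin n))) 0 :=
      HasFDerivAt.comp (g := fun p : ℝ × EuclideanSpace ℝ (Fin n) => Φ p.1 p.2)
        (f := fun y => ((0 : ℝ), y)) (0 : EuclideanSpace ℝ (Fin n))
        hΦs.hasFDerivAt (hasFDerivAt_prodMk_right (0 : ℝ) (0 : EuclideanSpace ℝ (Fin n)))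
    exact h1.unique ((hasFDerivAt_id _).congr_of_eventuallyEq hΦ0)
  have hBinr' : ∀ y, B (0, y) = y := fun y => by
    simpa using congrArg (fun L => L y) hBinr
  -- the time derivative
  have hBinl : deriv (fun t : ℝ => Φ t 0) 0 = B (1, 0) := by
    have h1 : HasFDerivAt (fun t => Φ t 0)
        (B ∘L .inl ℝ ℝ (EuclideanSpace ℝ (Fin n))) 0 :=
      HasFDerivAt.comp (g := fun p : ℝ × EuclideanSpace ℝ (Fin n) => Φ p.1 p.2)
        (f := fun t : ℝ => (t, (0 : EuclideanSpace ℝ (Fin n)))) (0 : ℝ)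
        hΦs.hasFDerivAt (hasFDerivAt_prodMk_left (0 : ℝ) (0 : EuclideanSpace ℝ (Fin n)))
    simpa using h1.hasDerivAt.deriv
  have hF : HasStrictFDerivAt
      (fun p : ℝ × EuclideanSpace ℝ (Fin n) => p.2 - Φ p.1 (f p.2))
      (.snd ℝ ℝ (EuclideanSpace ℝ (Fin n)) -
        B ∘L (.prod (.fst ℝ ℝ (EuclideanSpace ℝ (Fin n)))
          (A ∘L .snd ℝ ℝ (EuclideanSpace ℝ (Fin n))))) ((0 : ℝ), 0) := by
    refine hasStrictFDerivAt_snd.sub ?_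
    refine HasStrictFDerivAt.comp (g := fun p : ℝ × EuclideanSpace ℝ (Fin n) => Φ p.1 p.2)
        (f := fun p : ℝ × EuclideanSpace ℝ (Fin n) => (p.1, f p.2)) _ ?_ ?_
    · simpa [hf0] using hΦs
    · exact hasStrictFDerivAt_fst.prodMk
        (HasStrictFDerivAt.comp (g := f) (f := Prod.snd) _ hfs hasStrictFDerivAt_snd)
  set F' := (ContinuousLinearMap.snd ℝ ℝ (EuclideanSpace ℝ (Fin n)) -
        B ∘L (.prod (.fst ℝ ℝ (EuclideanSpace ℝ (Fin n)))
          (A ∘L .snd ℝ ℝ (EuclideanSpace ℝ (Fin n))))) with hF'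
  have hpart : F' ∘L .inr ℝ ℝ (EuclideanSpace ℝ (Fin n)) = .id ℝ _ - A := by
    ext1 y
    simp [hF', hBinr']
  have hinv : (F' ∘L .inr ℝ ℝ (EuclideanSpace ℝ (Fin n))).IsInvertible := by
    rw [hpart]
    exact ⟨ContinuousLinearEquiv.unitsEquiv ℝ _ (Units.oneSub A hDf), rfl⟩
  have hiff := hF.eventually_apply_eq_iff_implicitFunctionOfProdDomain hinv
  have htend := hF.tendsto_implicitFunctionOfProdDomain hinv
  have hder := hF.hasStrictFDerivAt_implicitFunctionOfProdDomain hinv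
  set x := hF.implicitFunctionOfProdDomain hinv
  have hΦ00 : Φ 0 0 = 0 := hΦ0.self_of_nhds
  have hx0 : x 0 = 0 := hiff.self_of_nhds.mp rfl
  simp only [hf0, hΦ00, sub_zero, sub_eq_zero] at hiff
  rw [nhds_prod_eq] at hiff
  obtain ⟨U, hU, W, hW, hUW⟩ := Filter.eventually_prod_iff.mp hiff
  have hev : ∀ᶠ t in 𝓝 (0 : ℝ), U t ∧ W (x t) := hU.and (htend.eventually hW)
  obtain ⟨ε, hε, hball⟩ := Metric.eventually_nhds_iff_ball.mp hev
  refine ⟨ε, hε, {y | W y}, hW, x, hx0, ?_, _, hder.hasFDerivAt.hasDerivAt, ?_⟩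
  · intro t ht
    have ht' := hball t (by rw [Real.ball_eq_Ioo]; simpa using ht)
    refine ⟨ht'.2, fun y hy => ?_⟩
    have := hUW ht'.1 hy
    constructor
    · intro h
      exact (this.mp h.symm).symm
    · intro h
      exact (this.mpr h.symm).symm
  · rw [← hpart, hBinl]
    obtain ⟨e, he⟩ := hinv
    rw [← he]
    simp [hF']
end

section
/- Let X be a nonempty complete metric space and let G be a group acting on X by isometries. Let 0 ≤ λ < 1 and let f : X → X be λ-Lipschitz; for each g ∈ G let π(g) denote the unique fixed point of the map x ↦ g • f(x). Let Γ be a group and j, ρ : Γ → G two group homomorphisms such that f is (j, ρ)-equivariant, i.e. f(j(γ) • x) = ρ(γ) • f(x) for all γ ∈ Γ and x ∈ X. Then for all γ ∈ Γ and g ∈ G, π( j(γ) · g · ρ(γ)^{−1} ) = j(γ) • π(g). -/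
/-- Let `G` act by isometries on a nonempty complete metric space `X`, let `f : X → X` be
`λ`-Lipschitz with `λ < 1`, and, for `g ∈ G`, let `π g` be the unique fixed point of
`x ↦ g • f x`. If `j, ρ : Γ →* G` and `f` is `(j, ρ)`-equivariant, then
`π (j γ * g * (ρ γ)⁻¹) = j γ • π g` for all `γ ∈ Γ` and `g ∈ G`. -/
theorem fixed_point_map_equivariant
    {X : Type*} [MetricSpace X] [Nonempty X] [CompleteSpace X]
    {G : Type*} [Group G] [MulAction G X]
    (hiso : ∀ (g : G) (x y : X), dist (g • x) (g • y) = dist x y)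
    (lam : NNReal) (hlam : lam < 1)
    (f : X → X) (hf : LipschitzWith lam f)
    (π : G → X)
    (hπ : ∀ g : G, g • f (π g) = π g)
    (hπuniq : ∀ (g : G) (x : X), g • f x = x → x = π g)
    {Γ : Type*} [Group Γ] (j ρ : Γ →* G)
    (hequiv : ∀ (γ : Γ) (x : X), f (j γ • x) = ρ γ • f x) :
    ∀ (γ : Γ) (g : G), π (j γ * g * (ρ γ)⁻¹) = j γ • π g := by
  intro γ g
  symm
  apply hπuniq
  rw [hequiv, mul_smul, inv_smul_smul, mul_smul, hπ]
end
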